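/- There is a universal constant a > 0 such that for every N ≥ 2 and every total Boolean function f : {0,1}^N → {0,1}, the cheat sheet version f_CS satisfies UC_0(f_CS) ≤ a · UC(f) · (log₂ N)². -/

import Mathlib

/-! ### Partial assignments and certificate complexity -/

/-- An input `x` is consistent with a partial assignment `p` if it agrees with
`p` wherever `p` is defined. -/
def Consistent {n : ℕ} (x : Fin n → Bool) (p : Fin n → Option Bool) : Prop :=
  ∀ i : Fin n, ∀ b : Bool, p i = some b → x i = b

instance {n : ℕ} (x : Fin n → Bool) (p : Fin n → Option Bool) :
    Decidable (Consistent x p) := by unfold Consistent; infer_instance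

/-- The width of a partial assignment: the number of fixed coordinates. -/
def paWidth {n : ℕ} (p : Fin n → Option Bool) : ℕ :=
  (Finset.univ.filter (fun i : Fin n => (p i).isSome)).card

/-- `p` is a `b`-certificate for `f`: every input consistent with `p` has value `b`. -/
def IsCert {n : ℕ} (f : (Fin n → Bool) → Bool) (b : Bool) (p : Fin n → Option Bool) : Prop :=
  ∀ x : Fin n → Bool, Consistent x p → f x = b

instance {n : ℕ} (f : (Fin n → Bool) → Bool) (b : Bool) (p : Fin n → Option Bool) :
    Decidable (IsCert f b p) := by unfold IsCert; infer_instance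

/-- The `b`-certificate complexity `C_b(f)`. -/
noncomputable def certC {n : ℕ} (f : (Fin n → Bool) → Bool) (b : Bool) : ℕ :=
  sInf {w : ℕ | ∀ x : Fin n → Bool, f x = b →
    ∃ p : Fin n → Option Bool, IsCert f b p ∧ paWidth p ≤ w ∧ Consistent x p}

/-- The certificate complexity `C(f) = max{C_0(f), C_1(f)}`. -/
noncomputable def certCC {n : ℕ} (f : (Fin n → Bool) → Bool) : ℕ :=
  max (certC f false) (certC f true)

/-- The unambiguous `b`-certificate complexity `UC_b(f)`. -/
noncomputable def UCb {n : ℕ} (f : (Fin n → Bool) → Bool) (b : Bool) : ℕ :=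
  sInf {w : ℕ | ∃ S : Set (Fin n → Option Bool),
    (∀ p ∈ S, IsCert f b p ∧ paWidth p ≤ w) ∧
    ∀ x : Fin n → Bool, f x = b → ∃! p, p ∈ S ∧ Consistent x p}

/-- Subcube partition complexity `UC(f) = max{UC_0(f), UC_1(f)}`. -/
noncomputable def UC {n : ℕ} (f : (Fin n → Bool) → Bool) : ℕ :=
  max (UCb f false) (UCb f true)

/-! ### The cheat sheet construction -/

/-- Interpret `g 0, …, g (L-1)` as the binary representation of a number. -/
def bitsToNat (L : ℕ) (g : ℕ → Bool) : ℕ :=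
  ∑ t ∈ Finset.range L, if g t then 2 ^ t else 0

/-- Read position `p` of the cell `Y` (`0` when the cell is empty). -/
def cellBit {m : ℕ} (Y : Fin m → Bool) (p : ℕ) : Bool :=
  if h : p % m < m then Y ⟨p % m, h⟩ else false

/-- Decode the `i`-th partial assignment stored in the cell `Y`: it is given by
`Cf` pairs, each consisting of an index (written in `L` bits) and a value bit. -/
def decodePA (N L Cf : ℕ) {m : ℕ} (Y : Fin m → Bool) (i : ℕ) : Fin N → Option Bool :=
  fun j =>
    ((List.range Cf).find? (fun t =>
        bitsToNat L (fun s => cellBit Y ((i * Cf + t) * (L + 1) + s)) == (j : ℕ))).map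
      (fun t => cellBit Y ((i * Cf + t) * (L + 1) + L))

/-- The cheat sheet version of `f`, on its natural (structured) input domain:
`c` inputs to `f` together with `2^c` cells of `m` bits each. -/
noncomputable def cheatSheetAux {N : ℕ} (f : (Fin N → Bool) → Bool) :
    ((Fin (10 * Nat.clog 2 N) × Fin N) ⊕
      (Fin (2 ^ (10 * Nat.clog 2 N)) × Fin (10 * certCC f * (Nat.clog 2 N) ^ 2)) → Bool)
    → Bool :=
  fun z =>
    let c := 10 * Nat.clog 2 N
    let x : Fin c → (Fin N → Bool) := fun i j => z (Sum.inl (i, j))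
    let ℓb : Fin c → Bool := fun i => f (x i)
    let ℓ : ℕ := ∑ i : Fin c, if ℓb i then 2 ^ (c - 1 - (i : ℕ)) else 0
    let Y : Fin (10 * certCC f * (Nat.clog 2 N) ^ 2) → Bool :=
      fun j => z (Sum.inr (⟨ℓ % 2 ^ c, Nat.mod_lt _ (by positivity)⟩, j))
    decide (∀ i : Fin c,
      Consistent (x i) (decodePA N (Nat.clog 2 N) (certCC f) Y (i : ℕ)) ∧
      IsCert f (ℓb i) (decodePA N (Nat.clog 2 N) (certCC f) Y (i : ℕ)))

/-- Number of input bits of the cheat sheet version of an `N`-bit function with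
certificate complexity `Cf`. -/
def csCard (N Cf : ℕ) : ℕ :=
  10 * Nat.clog 2 N * N + 2 ^ (10 * Nat.clog 2 N) * (10 * Cf * (Nat.clog 2 N) ^ 2)

/-- Relabelling of the structured cheat sheet domain as a set of `csCard N Cf` bits. -/
def csIndex (N Cf : ℕ) :
    (Fin (10 * Nat.clog 2 N) × Fin N) ⊕
      (Fin (2 ^ (10 * Nat.clog 2 N)) × Fin (10 * Cf * (Nat.clog 2 N) ^ 2))
    ≃ Fin (csCard N Cf) :=
  (Equiv.sumCongr finProdFinEquiv finProdFinEquiv).trans finSumFinEquiv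

/-- The cheat sheet version `f_CS` of `f`, as a total Boolean function on
`csCard N (C f)` bits. -/
noncomputable def cheatSheet {N : ℕ} (f : (Fin N → Bool) → Bool) :
    (Fin (csCard N (certCC f)) → Bool) → Bool :=
  fun z => cheatSheetAux f (fun u => z (csIndex N (certCC f) u))

/-! ### Local query sets and unambiguous certificates -/

/-- `Q` assigns to each input a set of coordinates, in such a way that the input restricted to
these coordinates determines both the set itself and the value of `g`. -/
def IsLocalQuery {ι α : Type*} (g : (ι → Bool) → α) (Q : (ι → Bool) → Finset ι) : Prop :=
  ∀ z z' : ι → Bool, (∀ i ∈ Q z, z' i = z i) → Q z' = Q z ∧ g z' = g z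

/-- The partial assignment that records `z` on the coordinates in `s`. -/
def restrictPA {n : ℕ} (z : Fin n → Bool) (s : Finset (Fin n)) : Fin n → Option Bool :=
  fun i => if i ∈ s then some (z i) else none

theorem consistent_restrictPA_iff {n : ℕ} {x z : Fin n → Bool} {s : Finset (Fin n)} :
    Consistent x (restrictPA z s) ↔ ∀ i ∈ s, x i = z i := by
  constructor
  · intro h i hi
    exact h i (z i) (by simp [restrictPA, hi])
  · intro h i b hb
    by_cases hi : i ∈ s
    · rw [h i hi]
      simpa [restrictPA, hi] using hb
    · simp [restrictPA, hi] at hb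

theorem paWidth_restrictPA {n : ℕ} (z : Fin n → Bool) (s : Finset (Fin n)) :
    paWidth (restrictPA z s) = s.card := by
  unfold paWidth
  congr 1
  ext i
  by_cases hi : i ∈ s <;> simp [restrictPA, hi]

theorem IsLocalQuery.UCb_le {n w : ℕ} {g : (Fin n → Bool) → Bool}
    {Q : (Fin n → Bool) → Finset (Fin n)} (hQ : IsLocalQuery g Q)
    (hw : ∀ z, (Q z).card ≤ w) (b : Bool) : UCb g b ≤ w := by
  apply Nat.sInf_le
  refine ⟨{p | ∃ z, g z = b ∧ p = restrictPA z (Q z)}, ?_, ?_⟩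
  · rintro p ⟨z, hz, rfl⟩
    refine ⟨fun x hx => ?_, (paWidth_restrictPA z (Q z)).trans_le (hw z)⟩
    rw [(hQ z x (consistent_restrictPA_iff.1 hx)).2, hz]
  · intro x hx
    refine ⟨restrictPA x (Q x), ⟨⟨x, hx, rfl⟩, consistent_restrictPA_iff.2 fun _ _ => rfl⟩, ?_⟩
    rintro p ⟨⟨z, -, rfl⟩, hp⟩
    rw [consistent_restrictPA_iff] at hp
    rw [(hQ z x hp).1]
    funext i
    by_cases hi : i ∈ Q z
    · simp [restrictPA, hi, hp i hi]
    · simp [restrictPA, hi]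

theorem IsLocalQuery.comp_equiv {ι κ α : Type*} {g : (ι → Bool) → α}
    {Q : (ι → Bool) → Finset ι} (hQ : IsLocalQuery g Q) (e : ι ≃ κ) :
    IsLocalQuery (fun z : κ → Bool => g fun u => z (e u))
      (fun z => (Q fun u => z (e u)).map e.toEmbedding) := by
  intro z z' h
  have := hQ (fun u => z (e u)) (fun u => z' (e u))
    fun i hi => h (e i) (Finset.mem_map_of_mem _ hi)
  exact ⟨by simp only [this.1], this.2⟩

theorem UCb_spec {n : ℕ} (f : (Fin n → Bool) → Bool) (b : Bool) :
    ∃ S : Set (Fin n → Option Bool), (∀ p ∈ S, IsCert f b p ∧ paWidth p ≤ UCb f b) ∧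
      ∀ x : Fin n → Bool, f x = b → ∃! p, p ∈ S ∧ Consistent x p := by
  apply Nat.sInf_mem (s := {w : ℕ | ∃ S : Set (Fin n → Option Bool),
    (∀ p ∈ S, IsCert f b p ∧ paWidth p ≤ w) ∧
    ∀ x : Fin n → Bool, f x = b → ∃! p, p ∈ S ∧ Consistent x p})
  refine ⟨n, {p | ∃ z, f z = b ∧ p = restrictPA z Finset.univ}, ?_, ?_⟩
  · rintro p ⟨z, hz, rfl⟩
    refine ⟨fun x hx => ?_, by simp [paWidth_restrictPA]⟩
    have : x = z := funext fun i => consistent_restrictPA_iff.1 hx i (Finset.mem_univ i)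
    rw [this, hz]
  · intro x hx
    refine ⟨_, ⟨⟨x, hx, rfl⟩, consistent_restrictPA_iff.2 fun _ _ => rfl⟩, ?_⟩
    rintro p ⟨⟨z, -, rfl⟩, hp⟩
    have : x = z := funext fun i => consistent_restrictPA_iff.1 hp i (Finset.mem_univ i)
    rw [this]

theorem certC_le_UCb {n : ℕ} (f : (Fin n → Bool) → Bool) (b : Bool) : certC f b ≤ UCb f b := by
  obtain ⟨S, hS, hx⟩ := UCb_spec f b
  apply Nat.sInf_le
  intro x hb
  obtain ⟨p, ⟨hp, hc⟩, -⟩ := hx x hb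
  exact ⟨p, (hS p hp).1, (hS p hp).2, hc⟩

theorem certCC_le_UC {n : ℕ} (f : (Fin n → Bool) → Bool) : certCC f ≤ UC f :=
  max_le_max (certC_le_UCb f false) (certC_le_UCb f true)

theorem UCb_le_UC {n : ℕ} (f : (Fin n → Bool) → Bool) (b : Bool) : UCb f b ≤ UC f := by
  cases b
  · exact le_max_left _ _
  · exact le_max_right _ _

/-- The coordinates fixed by a partial assignment. -/
def paSupport {n : ℕ} (p : Fin n → Option Bool) : Finset (Fin n) :=
  Finset.univ.filter fun i => (p i).isSome

theorem Consistent.congr {n : ℕ} {x x' : Fin n → Bool} {p : Fin n → Option Bool}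
    (hx : Consistent x p) (h : ∀ i ∈ paSupport p, x' i = x i) : Consistent x' p := by
  intro i b hb
  rw [h i (by simp [paSupport, hb])]
  exact hx i b hb

theorem consistent_congr {n : ℕ} {x x' : Fin n → Bool} {p : Fin n → Option Bool}
    (h : ∀ i ∈ paSupport p, x' i = x i) : Consistent x' p ↔ Consistent x p :=
  ⟨fun hx => hx.congr fun i hi => (h i hi).symm, fun hx => hx.congr h⟩

theorem exists_isLocalQuery_card_le_UC {n : ℕ} (f : (Fin n → Bool) → Bool) :
    ∃ R : (Fin n → Bool) → Finset (Fin n), IsLocalQuery f R ∧ ∀ x, (R x).card ≤ UC f := by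
  choose S hS hx using UCb_spec f
  choose q hq hu using fun x => hx (f x) x rfl
  refine ⟨fun x => paSupport (q x), fun x x' h => ?_,
    fun x => (hS _ _ (hq x).1).2.trans (UCb_le_UC f _)⟩
  have hc : Consistent x' (q x) := (hq x).2.congr h
  have hf : f x' = f x := (hS _ _ (hq x).1).1 x' hc
  have hqq : q x = q x' := hu x' (q x) ⟨hf ▸ (hq x).1, hc⟩
  exact ⟨by simp only [hqq], hf⟩

/-! ### A local query set for the cheat sheet version -/

theorem card_paSupport_decodePA_le (N L Cf : ℕ) {m : ℕ} (Y : Fin m → Bool) (i : ℕ) :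
    (paSupport (decodePA N L Cf Y i)).card ≤ Cf := by
  rw [← Finset.card_map Fin.valEmbedding]
  refine (Finset.card_le_card (t := (Finset.range Cf).image fun t =>
    bitsToNat L fun s => cellBit Y ((i * Cf + t) * (L + 1) + s)) ?_).trans
    (Finset.card_image_le.trans_eq (Finset.card_range Cf))
  intro k hk
  obtain ⟨j, hj, rfl⟩ := Finset.mem_map.1 hk
  simp only [paSupport, decodePA, Finset.mem_filter, Option.isSome_map,
    List.find?_isSome, List.mem_range, beq_iff_eq] at hj
  obtain ⟨-, t, ht, h⟩ := hj
  exact Finset.mem_image.2 ⟨t, Finset.mem_range.2 ht, h⟩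

/-- The structured index set of the cheat sheet version. -/
abbrev CSDomain (N Cf : ℕ) : Type :=
  (Fin (10 * Nat.clog 2 N) × Fin N) ⊕
    (Fin (2 ^ (10 * Nat.clog 2 N)) × Fin (10 * Cf * (Nat.clog 2 N) ^ 2))

/-- The `i`-th input to `f` inside an input of the cheat sheet version. -/
def csInput {N Cf : ℕ} (z : CSDomain N Cf → Bool) (i : Fin (10 * Nat.clog 2 N)) :
    Fin N → Bool :=
  fun j => z (Sum.inl (i, j))

/-- The number of the cell addressed by the values of `f`. -/
def csAddress {N Cf : ℕ} (f : (Fin N → Bool) → Bool) (z : CSDomain N Cf → Bool) :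
    Fin (2 ^ (10 * Nat.clog 2 N)) :=
  ⟨(∑ i : Fin (10 * Nat.clog 2 N),
      if f (csInput z i) then 2 ^ (10 * Nat.clog 2 N - 1 - (i : ℕ)) else 0) %
    2 ^ (10 * Nat.clog 2 N), Nat.mod_lt _ (by positivity)⟩

/-- The content of the cell addressed by the values of `f`. -/
def csCell {N Cf : ℕ} (f : (Fin N → Bool) → Bool) (z : CSDomain N Cf → Bool) :
    Fin (10 * Cf * (Nat.clog 2 N) ^ 2) → Bool :=
  fun j => z (Sum.inr (csAddress f z, j))

/-- The `i`-th partial assignment stored in the addressed cell. -/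
def csDecoded {N Cf : ℕ} (f : (Fin N → Bool) → Bool) (z : CSDomain N Cf → Bool)
    (i : Fin (10 * Nat.clog 2 N)) : Fin N → Option Bool :=
  decodePA N (Nat.clog 2 N) Cf (csCell f z) (i : ℕ)

theorem cheatSheetAux_eq {N : ℕ} (f : (Fin N → Bool) → Bool)
    (z : CSDomain N (certCC f) → Bool) :
    cheatSheetAux f z = decide (∀ i, Consistent (csInput z i) (csDecoded f z i) ∧
      IsCert f (f (csInput z i)) (csDecoded f z i)) :=
  rfl

/-- Query the sets `R` of all inputs to `f`, the addressed cell, and all coordinates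
fixed by the partial assignments stored in it. -/
def csQuery {N Cf : ℕ} (f : (Fin N → Bool) → Bool) (R : (Fin N → Bool) → Finset (Fin N))
    (z : CSDomain N Cf → Bool) : Finset (CSDomain N Cf) :=
  (Finset.univ.biUnion fun i =>
    (R (csInput z i) ∪ paSupport (csDecoded f z i)).image fun j => Sum.inl (i, j)) ∪
  Finset.univ.image fun j => Sum.inr (csAddress f z, j)

theorem isLocalQuery_csQuery {N : ℕ} {f : (Fin N → Bool) → Bool}
    {R : (Fin N → Bool) → Finset (Fin N)} (hR : IsLocalQuery f R) :
    IsLocalQuery (cheatSheetAux f) (csQuery f R) := by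
  intro z z' h
  have hin : ∀ i, ∀ j ∈ R (csInput z i) ∪ paSupport (csDecoded f z i),
      csInput z' i j = csInput z i j := fun i j hj =>
    h _ (Finset.mem_union_left _ (Finset.mem_biUnion.2
      ⟨i, Finset.mem_univ i, Finset.mem_image_of_mem _ hj⟩))
  have hloc := fun i => hR (csInput z i) (csInput z' i)
    fun j hj => hin i j (Finset.mem_union_left _ hj)
  have haddr : csAddress f z' = csAddress f z := by
    simp only [csAddress, fun i => (hloc i).2]
  have hcell : csCell f z' = csCell f z := by
    funext j
    unfold csCell
    rw [haddr]
    exact h _ (Finset.mem_union_right _ (Finset.mem_image_of_mem _ (Finset.mem_univ j)))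
  have hdec : csDecoded f z' = csDecoded f z := by
    funext i
    simp only [csDecoded, hcell]
  have hcons : ∀ i, Consistent (csInput z' i) (csDecoded f z i) ↔
      Consistent (csInput z i) (csDecoded f z i) := fun i =>
    consistent_congr fun j hj => hin i j (Finset.mem_union_right _ hj)
  constructor
  · simp only [csQuery, haddr, hdec, fun i => (hloc i).1]
  · simp only [cheatSheetAux_eq, hdec, hcons, fun i => (hloc i).2]

theorem card_csQuery_le {N Cf w : ℕ} (f : (Fin N → Bool) → Bool)
    {R : (Fin N → Bool) → Finset (Fin N)} (hw : ∀ x, (R x).card ≤ w)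
    (z : CSDomain N Cf → Bool) :
    (csQuery f R z).card ≤ 10 * Nat.clog 2 N * (w + Cf) + 10 * Cf * (Nat.clog 2 N) ^ 2 := by
  refine (Finset.card_union_le _ _).trans (Nat.add_le_add ?_ ?_)
  · refine (Finset.card_biUnion_le_card_mul _ _ (w + Cf) fun i _ => ?_).trans_eq (by simp)
    exact Finset.card_image_le.trans ((Finset.card_union_le _ _).trans
      (Nat.add_le_add (hw _) (card_paSupport_decodePA_le _ _ _ _ _)))
  · exact Finset.card_image_le.trans_eq (by simp)

theorem UCb_cheatSheet_le {N : ℕ} (f : (Fin N → Bool) → Bool) (b : Bool) :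
    UCb (cheatSheet f) b ≤
      10 * Nat.clog 2 N * (UC f + certCC f) + 10 * certCC f * (Nat.clog 2 N) ^ 2 := by
  obtain ⟨R, hR, hw⟩ := exists_isLocalQuery_card_le_UC f
  refine ((isLocalQuery_csQuery hR).comp_equiv (csIndex N (certCC f))).UCb_le (fun z => ?_) b
  rw [Finset.card_map]
  exact card_csQuery_le f hw _

theorem clog_two_le_two_mul_logb {N : ℕ} (hN : 2 ≤ N) :
    (Nat.clog 2 N : ℝ) ≤ 2 * Real.logb 2 N := by
  have h1 : 1 ≤ Real.logb 2 N := by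
    rw [Real.le_logb_iff_rpow_le (by norm_num) (by positivity), Real.rpow_one]
    exact_mod_cast hN
  have h2 := Nat.ceil_lt_add_one (zero_le_one.trans h1)
  have h3 : ⌈Real.logb (2 : ℕ) N⌉₊ = Nat.clog 2 N := Real.natCeil_logb_natCast 2 N
  push_cast at h3
  rw [h3] at h2
  linarith

theorem stmt15 :
    ∃ a : ℝ, 0 < a ∧ ∀ N : ℕ, 2 ≤ N → ∀ f : (Fin N → Bool) → Bool,
      (UCb (cheatSheet f) false : ℝ) ≤ a * UC f * Real.logb 2 N ^ 2 := by
  refine ⟨120, by norm_num, fun N hN f => ?_⟩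
  have hL : 1 ≤ Nat.clog 2 N := Nat.clog_pos one_lt_two hN
  have hnat : UCb (cheatSheet f) false ≤ 30 * UC f * Nat.clog 2 N ^ 2 := calc
    _ ≤ _ := UCb_cheatSheet_le f false
    _ ≤ 10 * Nat.clog 2 N ^ 2 * (UC f + UC f) + 10 * UC f * Nat.clog 2 N ^ 2 := by
      have := certCC_le_UC f
      have := Nat.le_self_pow two_ne_zero (Nat.clog 2 N)
      gcongr
    _ = 30 * UC f * Nat.clog 2 N ^ 2 := by ring
  calc (UCb (cheatSheet f) false : ℝ) ≤ 30 * UC f * (Nat.clog 2 N : ℝ) ^ 2 := by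
        exact_mod_cast hnat
    _ ≤ 30 * UC f * (2 * Real.logb 2 N) ^ 2 := by
      gcongr
      exact clog_two_le_two_mul_logb hN
    _ = 120 * UC f * Real.logb 2 N ^ 2 := by ring
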